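/- (Main incidence bound, case d ≥ 2.) Let P ⊆ F_q^{n+d} be a set of points and V a set of varieties of the form V_{a_1,...,a_d} = {(x, h_1(x)+f_{a_1}(x),...,h_d(x)+f_{a_d}(x)) : x ∈ F_q^n}, where f_{a_i}(x) = Σ_j a_{i,j} x_j^{b_{i,j}} + a_{i,n+1} with gcd(b_{i,j}, q−1)=1. Then for d ≥ 2, |I(P,V) − |P||V|/q^d| ≤ q^{n/2} √(|P||V|) (1 + |V|/q)^{1/2}. -/

import Mathlib

theorem aux_pow_inj {F : Type*} [Field F] [Fintype F] (b : ℕ) (hb0 : 0 < b)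
    (hb : Nat.Coprime b (Fintype.card F - 1)) : Function.Injective (fun x : F => x ^ b) := by
  classical
  intro x y hxy
  simp only at hxy
  by_cases hx : x = 0
  · subst hx
    rw [zero_pow hb0.ne'] at hxy
    exact (pow_eq_zero_iff hb0.ne' |>.1 hxy.symm).symm
  by_cases hy : y = 0
  · subst hy
    rw [zero_pow hb0.ne'] at hxy
    exact (pow_eq_zero_iff hb0.ne' |>.1 hxy)
  have hc : (Nat.card Fˣ).Coprime b := by
    rw [Nat.card_eq_fintype_card, Fintype.card_units]
    exact hb.symm
  have := (powCoprime hc).injective (a₁ := Units.mk0 x hx) (a₂ := Units.mk0 y hy) (by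
    ext
    simpa using hxy)
  simpa using congrArg Units.val this

theorem aux_count {F : Type*} [Field F] [Fintype F] [DecidableEq F] (n : ℕ) (b : Fin n → ℕ)
    (hb : ∀ j, Function.Injective (fun x : F => x ^ b j))
    (c : Fin n → F) (c0 : F) (hc : c ≠ 0 ∨ c0 ≠ 0) :
    ((Finset.univ.filter (fun x : Fin n → F => ∑ j, c j * x j ^ b j + c0 = 0)).card : ℝ)
      ≤ (Fintype.card F : ℝ) ^ n / Fintype.card F := by
  have hq : (0 : ℝ) < Fintype.card F := by exact_mod_cast Fintype.card_pos
  by_cases h0 : c = 0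
  · have : c0 ≠ 0 := by tauto
    simp [h0, this]
    positivity
  obtain ⟨j, hj⟩ := Function.ne_iff.1 h0
  simp only [Pi.zero_apply] at hj
  rw [le_div_iff₀ hq]
  have hcard : (Finset.univ.filter (fun x : Fin n → F => ∑ j, c j * x j ^ b j + c0 = 0)).card
      ≤ Fintype.card ({k : Fin n // k ≠ j} → F) := by
    rw [← Finset.card_univ]
    apply Finset.card_le_card_of_injOn (fun x k => x k.1) (by simp)
    intro x hx y hy hxy
    simp only [Finset.coe_filter, Finset.mem_univ, true_and, Set.mem_setOf_eq] at hx hy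
    have hne : ∀ k, k ≠ j → x k = y k := fun k hk => congrFun hxy ⟨k, hk⟩
    rw [← Finset.add_sum_erase _ _ (Finset.mem_univ j)] at hx hy
    have hs : ∑ k ∈ Finset.univ.erase j, c k * x k ^ b k
        = ∑ k ∈ Finset.univ.erase j, c k * y k ^ b k :=
      Finset.sum_congr rfl fun k hk => by rw [hne k (Finset.ne_of_mem_erase hk)]
    rw [hs] at hx
    have h1 : c j * x j ^ b j = c j * y j ^ b j := by linear_combination hx - hy
    have h2 := hb j (mul_left_cancel₀ hj h1)
    funext k
    by_cases hk : k = j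
    · rw [hk]; exact h2
    · exact hne k hk
  have he : Fintype.card ({k : Fin n // k ≠ j} → F) * Fintype.card F = Fintype.card F ^ n := by
    have hn : 1 ≤ n := by have := j.2; omega
    rw [Fintype.card_fun, ← pow_succ]
    congr 1
    simp
    omega
  calc _ ≤ ((Fintype.card ({k : Fin n // k ≠ j} → F) : ℕ) : ℝ) * Fintype.card F := by
        gcongr
    _ = _ := by exact_mod_cast he

open Classical in
theorem aux_moment {α : Type*} [Fintype α] (P : Finset α) (V : Finset (Set α)) (K q D : ℝ)
    (hq : 0 < q) (hK : 0 ≤ K) (hD : 0 < D) (hcard : (Fintype.card α : ℝ) = K * D)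
    (h1 : ∀ W ∈ V, ((Finset.univ.filter (· ∈ W)).card : ℝ) = K)
    (h2 : ∀ W ∈ V, ∀ W' ∈ V, W ≠ W' →
      ((Finset.univ.filter (fun p => p ∈ W ∧ p ∈ W')).card : ℝ) ≤ K / q) :
    |(Nat.card {x : α × Set α // x.1 ∈ P ∧ x.2 ∈ V ∧ x.1 ∈ x.2} : ℝ)
      - P.card * V.card / D| ≤ √K * √(P.card * V.card) * √(1 + V.card / q) := by
  set deg : α → ℝ := fun p => ∑ W ∈ V, if p ∈ W then 1 else 0 with hdeg
  set v : ℝ := (V.card : ℝ) with hv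
  have hN : (Nat.card {x : α × Set α // x.1 ∈ P ∧ x.2 ∈ V ∧ x.1 ∈ x.2} : ℝ)
      = ∑ p ∈ P, deg p := by
    have : Nat.card {x : α × Set α // x.1 ∈ P ∧ x.2 ∈ V ∧ x.1 ∈ x.2}
        = ((P ×ˢ V).filter (fun x => x.1 ∈ x.2)).card := by
      rw [Nat.card_eq_fintype_card, Fintype.card_subtype]
      congr 1
      ext x
      simp [and_assoc]
    rw [this, Finset.card_filter, Finset.sum_product]
    push_cast
    rfl
  have hS1 : ∑ p, deg p = v * K := by
    rw [hdeg, Finset.sum_comm]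
    rw [Finset.sum_congr rfl (g := fun _ => K)]
    · simp [hv]
    · intro W hW
      rw [← h1 W hW, Finset.card_filter]
      push_cast
      rfl
  have hS2 : ∑ p, deg p ^ 2 ≤ v * K + v ^ 2 * (K / q) := by
    have : ∑ p, deg p ^ 2 = ∑ W ∈ V, ∑ W' ∈ V,
        ((Finset.univ.filter (fun p => p ∈ W ∧ p ∈ W')).card : ℝ) := by
      simp only [hdeg, sq, Finset.sum_mul_sum]
      rw [Finset.sum_comm]
      refine Finset.sum_congr rfl fun W _ => ?_
      rw [Finset.sum_comm]
      refine Finset.sum_congr rfl fun W' _ => ?_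
      rw [Finset.card_filter]
      push_cast
      refine Finset.sum_congr rfl fun p _ => ?_
      by_cases a : p ∈ W <;> by_cases b : p ∈ W' <;> simp [a, b]
    rw [this]
    calc _ ≤ ∑ W ∈ V, ∑ W' ∈ V, ((if W = W' then K else 0) + K / q) := by
          refine Finset.sum_le_sum fun W hW => Finset.sum_le_sum fun W' hW' => ?_
          by_cases hWW : W = W'
          · subst hWW
            simp only [and_self, if_true]
            rw [h1 W hW]
            have : 0 ≤ K / q := by positivity
            linarith
          · simp only [hWW, if_false, zero_add]
            exact h2 W hW W' hW' hWW
      _ = _ := by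
          simp only [Finset.sum_add_distrib, Finset.sum_ite_eq, Finset.sum_const, nsmul_eq_mul]
          rw [Finset.sum_congr rfl (g := fun _ => K) (fun W hW => by simp [hW])]
          simp only [Finset.sum_const, nsmul_eq_mul]
          ring
  have hvar : ∑ p, (deg p - v / D) ^ 2 ≤ v * K * (1 + v / q) := by
    have : ∑ p, (deg p - v / D) ^ 2
        = ∑ p, deg p ^ 2 - 2 * (v / D) * ∑ p, deg p + (Fintype.card α : ℝ) * (v / D) ^ 2 := by
      rw [Finset.mul_sum, ← Finset.sum_sub_distrib, ← nsmul_eq_mul, ← Finset.card_univ,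
        ← Finset.sum_const, ← Finset.sum_add_distrib]
      exact Finset.sum_congr rfl fun p _ => by ring
    rw [this, hS1, hcard]
    have e : K * D * (v / D) ^ 2 = K * v ^ 2 / D := by field_simp
    have e2 : 2 * (v / D) * (v * K) = 2 * (K * v ^ 2 / D) := by field_simp
    have e3 : 0 ≤ K * v ^ 2 / D := by positivity
    have e4 : v * K * (1 + v / q) = v * K + v ^ 2 * (K / q) := by field_simp
    rw [e, e2, e4]
    linarith
  have hv0 : 0 ≤ v := by positivity
  rw [← Real.sqrt_mul hK, ← Real.sqrt_mul (by positivity)]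
  apply Real.abs_le_sqrt
  have hdiff : (Nat.card {x : α × Set α // x.1 ∈ P ∧ x.2 ∈ V ∧ x.1 ∈ x.2} : ℝ)
      - P.card * v / D = ∑ p ∈ P, (deg p - v / D) := by
    rw [hN, Finset.sum_sub_distrib, Finset.sum_const, nsmul_eq_mul, mul_div_assoc]
  rw [hdiff]
  calc _ ≤ (P.card : ℝ) * ∑ p ∈ P, (deg p - v / D) ^ 2 := sq_sum_le_card_mul_sum_sq
    _ ≤ (P.card : ℝ) * ∑ p, (deg p - v / D) ^ 2 := by
        gcongr
        exact Finset.subset_univ P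
    _ ≤ (P.card : ℝ) * (v * K * (1 + v / q)) := by gcongr
    _ = _ := by ring

/-- Main incidence bound, case `d ≥ 2`:
`|I(P,V) − |P||V|/q^d| ≤ q^{n/2}√(|P||V|)(1 + |V|/q)^{1/2}` for a point set
`P ⊆ F_q^{n+d}` and a set `V` of varieties of the form `V_{a_1,…,a_d}`. -/
theorem stmt_14 {F : Type*} [Field F] [Fintype F] (n d : ℕ) (hn : 1 ≤ n) (hd : 2 ≤ d)
    (h : Fin d → MvPolynomial (Fin n) F)
    (hdeg : ∀ i, (h i).totalDegree ≤ Fintype.card F - 1)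
    (b : Fin d → Fin n → ℕ)
    (hb : ∀ i j, 0 < b i j ∧ Nat.Coprime (b i j) (Fintype.card F - 1))
    (P : Finset ((Fin n → F) × (Fin d → F)))
    (𝒱 : Finset (Set ((Fin n → F) × (Fin d → F))))
    (h𝒱 : ∀ W ∈ 𝒱, ∃ a : Fin d → (Fin n → F) × F,
      W = {pt : (Fin n → F) × (Fin d → F) | ∀ i, pt.2 i =
        MvPolynomial.eval pt.1 (h i) + (∑ j, (a i).1 j * pt.1 j ^ (b i j)) + (a i).2}) :
    |(Nat.card {x : ((Fin n → F) × (Fin d → F)) × Set ((Fin n → F) × (Fin d → F)) //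
        x.1 ∈ P ∧ x.2 ∈ 𝒱 ∧ x.1 ∈ x.2} : ℝ)
      - P.card * 𝒱.card / (Fintype.card F : ℝ) ^ d|
      ≤ Real.sqrt ((Fintype.card F : ℝ) ^ n) * Real.sqrt (P.card * 𝒱.card)
        * Real.sqrt (1 + 𝒱.card / (Fintype.card F : ℝ)) := by
  classical
  have hq : (0 : ℝ) < Fintype.card F := by exact_mod_cast Fintype.card_pos
  refine aux_moment P 𝒱 ((Fintype.card F : ℝ) ^ n) (Fintype.card F) ((Fintype.card F : ℝ) ^ d)
    hq (by positivity) (by positivity) (by simp) ?_ ?_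
  · intro W hW
    obtain ⟨a, rfl⟩ := h𝒱 W hW
    have : Fintype.card F ^ n = (Finset.univ : Finset (Fin n → F)).card := by simp
    rw [← Nat.cast_pow, this]
    congr 1
    refine Finset.card_bij' (fun p _ => p.1) (fun x _ => (x, fun i =>
      MvPolynomial.eval x (h i) + (∑ j, (a i).1 j * x j ^ (b i j)) + (a i).2)) ?_ ?_ ?_ ?_
    · simp
    · simp
    · intro p hp
      simp only [Finset.mem_filter, Finset.mem_univ, true_and, Set.mem_setOf_eq] at hp
      exact Prod.ext rfl (funext fun i => (hp i).symm)
    · simp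
  · intro W hW W' hW' hne
    obtain ⟨a, rfl⟩ := h𝒱 W hW
    obtain ⟨a', rfl⟩ := h𝒱 W' hW'
    have haa : a ≠ a' := by rintro rfl; exact hne rfl
    obtain ⟨i, hi⟩ := Function.ne_iff.1 haa
    have hc : (a i).1 - (a' i).1 ≠ 0 ∨ (a i).2 - (a' i).2 ≠ 0 := by
      by_contra hcon
      push Not at hcon
      exact hi (Prod.ext (sub_eq_zero.1 hcon.1) (sub_eq_zero.1 hcon.2))
    refine le_trans ?_ (aux_count n (b i) (fun j => aux_pow_inj _ (hb i j).1 (hb i j).2)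
      ((a i).1 - (a' i).1) ((a i).2 - (a' i).2) hc)
    norm_cast
    apply Finset.card_le_card_of_injOn Prod.fst
    · intro p hp
      simp only [Finset.coe_filter, Finset.mem_univ, true_and, Set.mem_setOf_eq] at hp ⊢
      have e1 := hp.1 i
      have e2 := hp.2 i
      simp only [Pi.sub_apply, sub_mul, Finset.sum_sub_distrib]
      linear_combination e2 - e1
    · intro p hp p' hp' hpp
      simp only [Finset.coe_filter, Finset.mem_univ, true_and, Set.mem_setOf_eq] at hp hp'
      refine Prod.ext hpp (funext fun k => ?_)
      rw [hp.1 k, hp'.1 k, hpp]
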